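/- Let k and K be finite fields of odd characteristic, with K a k-algebra such that the degree [K : k] is odd. Let V₁ and V₂ be finite-dimensional k-vector spaces and let Q₁ and Q₂ be nondegenerate quadratic forms on V₁ and V₂ respectively. Then Q₁ and Q₂ are equivalent over k (there is a k-linear isometry equivalence between them) if and only if their base changes to K, the quadratic forms Q₁ ⊗ K on K ⊗_k V₁ and Q₂ ⊗ K on K ⊗_k V₂, are equivalent over K. -/

import Mathlib

open Polynomial in
/-- A binary form over a finite field of odd characteristic represents `1`. -/
theorem aux_represents_one {k : Type*} [Field k] [Fintype k] [Invertible (2 : k)]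
    {a b : k} (ha : a ≠ 0) (hb : b ≠ 0) : ∃ x y : k, a * x ^ 2 + b * y ^ 2 = 1 := by
  have h2 : ringChar k ≠ 2 := by
    intro h
    have : (2 : k) = 0 := by
      have := ringChar.Nat.cast_ringChar (R := k)
      rw [h] at this
      exact_mod_cast this
    exact (Invertible.ne_zero (2 : k)) this
  have hf : degree (C a * X ^ 2 : k[X]) = 2 := degree_C_mul_X_pow 2 ha
  have hg : degree (C b * X ^ 2 - C 1 : k[X]) = 2 := by
    rw [degree_sub_C, degree_C_mul_X_pow 2 hb]
    · rfl
    · rw [degree_C_mul_X_pow 2 hb]; norm_num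
  obtain ⟨x, y, h⟩ := FiniteField.exists_root_sum_quadratic hf hg
    (FiniteField.odd_card_of_char_ne_two h2)
  refine ⟨x, y, ?_⟩
  simp at h
  linear_combination h

/-- Replacing `⟨a, b, …⟩` by `⟨1, ab, …⟩`. -/
theorem aux_step {k : Type*} [Field k] [Fintype k] [Invertible (2 : k)] {n : ℕ}
    {a b : k} (ha : a ≠ 0) (hb : b ≠ 0) (w : Fin n → k) :
    (QuadraticMap.weightedSumSquares k (Fin.cons a (Fin.cons b w : Fin (n+1) → k) : Fin (n+2) → k)).Equivalent
    (QuadraticMap.weightedSumSquares k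
      (Fin.cons 1 (Fin.cons (a * b) w : Fin (n+1) → k) : Fin (n+2) → k)) := by
  obtain ⟨x, y, h⟩ := aux_represents_one ha hb
  let f : (Fin (n+2) → k) →ₗ[k] (Fin (n+2) → k) :=
    { toFun := fun v => Fin.cons (a * x * v 0 + b * y * v 1)
        (Fin.cons (-y * v 0 + x * v 1) (fun i => v i.succ.succ) : Fin (n+1) → k)
      map_add' := by
        intro u v
        funext i
        refine Fin.cases ?_ (fun i => Fin.cases ?_ (fun i => ?_) i) i <;> simp <;> ring
      map_smul' := by
        intro u v
        funext i
        refine Fin.cases ?_ (fun i => Fin.cases ?_ (fun i => ?_) i) i <;> simp <;> ring }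
  let g : (Fin (n+2) → k) →ₗ[k] (Fin (n+2) → k) :=
    { toFun := fun v => Fin.cons (x * v 0 - b * y * v 1)
        (Fin.cons (y * v 0 + a * x * v 1) (fun i => v i.succ.succ) : Fin (n+1) → k)
      map_add' := by
        intro u v
        funext i
        refine Fin.cases ?_ (fun i => Fin.cases ?_ (fun i => ?_) i) i <;> simp <;> ring
      map_smul' := by
        intro u v
        funext i
        refine Fin.cases ?_ (fun i => Fin.cases ?_ (fun i => ?_) i) i <;> simp <;> ring }
  have e1 : ∀ (p q : k) (r : Fin n → k),
    (Fin.cons p (Fin.cons q r : Fin (n+1) → k) : Fin (n+2) → k) 1 = q := fun p q r => rfl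
  have hfg : f ∘ₗ g = LinearMap.id := by
    refine LinearMap.ext fun v => ?_
    funext i
    refine Fin.cases ?_ (fun i => Fin.cases ?_ (fun i => ?_) i) i
    · simp [f, g, e1]; linear_combination (v 0) * h
    · simp [f, g, e1]; linear_combination (v 1) * h
    · simp [f, g]
  have hgf : g ∘ₗ f = LinearMap.id := by
    refine LinearMap.ext fun v => ?_
    funext i
    refine Fin.cases ?_ (fun i => Fin.cases ?_ (fun i => ?_) i) i
    · simp [f, g, e1]; linear_combination (v 0) * h
    · simp [f, g, e1]; linear_combination (v 1) * h
    · simp [f, g]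
  refine QuadraticMap.Equivalent.symm ⟨{ (LinearEquiv.ofLinearMap g f hgf hfg : (Fin (n+2) → k) ≃ₗ[k] (Fin (n+2) → k)) with map_app' := ?_ }⟩
  intro v
  simp [g, Fin.sum_univ_succ]
  linear_combination (v 0 ^ 2 + a * b * v 1 ^ 2) * h

theorem aux_cons {k : Type*} [Field k] {n : ℕ} (a : k) (w w' : Fin n → k)
    (h : (QuadraticMap.weightedSumSquares k w).Equivalent (QuadraticMap.weightedSumSquares k w')) :
    (QuadraticMap.weightedSumSquares k (Fin.cons a w : Fin (n+1) → k)).Equivalent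
    (QuadraticMap.weightedSumSquares k (Fin.cons a w' : Fin (n+1) → k)) := by
  obtain ⟨e⟩ := h
  let E := (Fin.consLinearEquiv k (fun _ : Fin (n+1) => k)).symm.trans
    (((LinearEquiv.refl k k).prodCongr e.toLinearEquiv).trans
      (Fin.consLinearEquiv k (fun _ : Fin (n+1) => k)))
  refine ⟨{ E with map_app' := ?_ }⟩
  intro v
  have := e.map_app (Fin.tail v)
  rw [QuadraticMap.weightedSumSquares_apply, QuadraticMap.weightedSumSquares_apply] at this
  simp [E, Fin.sum_univ_succ, Fin.consLinearEquiv, Fin.consEquiv]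
  exact this

theorem aux_classify {k : Type*} [Field k] [Fintype k] [Invertible (2 : k)] {n : ℕ} :
    ∀ (w w' : Fin n → k) (_ : ∀ i, w i ≠ 0) (_ : ∀ i, w' i ≠ 0) (c : k) (_ : c ≠ 0)
      (_ : ∏ i, w i = c * c * ∏ i, w' i),
    (QuadraticMap.weightedSumSquares k w).Equivalent (QuadraticMap.weightedSumSquares k w') := by
  induction n with
  | zero =>
    intro w w' _ _ c _ _
    rw [Subsingleton.elim w w']
  | succ n ih =>
    intro w w' hw hw' c hc h
    cases n with
    | zero =>
      refine ⟨{ LinearEquiv.smulOfNeZero k _ c hc with map_app' := ?_ }⟩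
      intro v
      simp at h
      simp [h]
      ring
    | succ n =>
      obtain ⟨a, w, rfl⟩ : ∃ a u, w = Fin.cons a u := ⟨_, _, (Fin.cons_self_tail w).symm⟩
      obtain ⟨b, w, rfl⟩ : ∃ a u, w = Fin.cons a u := ⟨_, _, (Fin.cons_self_tail w).symm⟩
      obtain ⟨a', w', rfl⟩ : ∃ a u, w' = Fin.cons a u := ⟨_, _, (Fin.cons_self_tail w').symm⟩
      obtain ⟨b', w', rfl⟩ : ∃ a u, w' = Fin.cons a u := ⟨_, _, (Fin.cons_self_tail w').symm⟩
      simp only [Fin.forall_fin_succ, Fin.cons_zero, Fin.cons_succ] at hw hw'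
      obtain ⟨ha, hb, hw⟩ := hw
      obtain ⟨ha', hb', hw'⟩ := hw'
      refine (aux_step ha hb w).trans (QuadraticMap.Equivalent.trans ?_ (aux_step ha' hb' w').symm)
      apply aux_cons
      apply ih _ _ _ _ c hc
      · simp only [Fin.prod_univ_succ, Fin.cons_zero, Fin.cons_succ] at h ⊢
        linear_combination h
      · intro i; refine Fin.cases ?_ (fun i => ?_) i <;> simp [*]
      · intro i; refine Fin.cases ?_ (fun i => ?_) i <;> simp [*]

theorem aux_discr {k V₁ V₂ : Type*} {n : ℕ} [Field k] [Invertible (2 : k)]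
    [AddCommGroup V₁] [Module k V₁] [AddCommGroup V₂] [Module k V₂]
    (b₁ : Module.Basis (Fin n) k V₁) (b₂ : Module.Basis (Fin n) k V₂)
    (Q₁ : QuadraticForm k V₁) (Q₂ : QuadraticForm k V₂) (h : Q₁.Equivalent Q₂) :
    ∃ c : k, c ≠ 0 ∧ Q₁.discr b₁ = c * c * Q₂.discr b₂ := by
  obtain ⟨e⟩ := h
  have : Q₁ = Q₂.comp (e.toLinearEquiv : V₁ →ₗ[k] V₂) := by
    ext v
    exact (e.map_app v).symm
  refine ⟨_, (LinearEquiv.isUnit_det e.toLinearEquiv b₁ b₂).ne_zero, ?_⟩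
  conv_lhs => rw [this]
  exact QuadraticForm.discr_comp b₂ Q₂ _

theorem aux_discr_wss {k : Type*} {n : ℕ} [Field k] [Invertible (2 : k)] (w : Fin n → k) :
    QuadraticForm.discr (Pi.basisFun k (Fin n)) (QuadraticMap.weightedSumSquares k w)
      = ∏ i, w i := by
  rw [QuadraticForm.discr, ← Matrix.det_diagonal]
  congr 1
  ext i j
  rw [QuadraticForm.toMatrix, LinearMap.toMatrix₂_apply]
  by_cases hij : i = j
  · subst hij
    rw [QuadraticMap.associated_eq_self_apply]
    simp [Pi.single_apply]
  rw [QuadraticMap.associated_apply]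
  simp only [QuadraticMap.weightedSumSquares_apply, Pi.basisFun_apply, Pi.add_apply,
    ← Finset.sum_sub_distrib, smul_eq_mul]
  · rw [Finset.sum_eq_zero]
    · simp [Matrix.diagonal, hij]
    · intro l _
      by_cases h1 : l = i
      · subst h1
        simp [hij]
      · simp [h1]

theorem aux_discr_baseChange {k K V : Type*} {n : ℕ} [Field k] [Field K] [Algebra k K]
    [Invertible (2 : k)] [Invertible (2 : K)]
    [AddCommGroup V] [Module k V] (b : Module.Basis (Fin n) k V) (Q : QuadraticForm k V) :
    (Q.baseChange K).discr (b.baseChange K) = algebraMap k K (Q.discr b) := by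
  rw [QuadraticForm.discr, QuadraticForm.discr, RingHom.map_det]
  congr 1
  ext i j
  simp only [QuadraticForm.toMatrix, LinearMap.toMatrix₂_apply, RingHom.mapMatrix_apply,
    Matrix.map_apply]
  rw [QuadraticForm.associated_baseChange, Module.Basis.baseChange_apply,
    Module.Basis.baseChange_apply, LinearMap.BilinForm.baseChange_tmul]
  simp [Algebra.algebraMap_eq_smul_one]

theorem aux_square {k K : Type*} [Field k] [Field K] [Algebra k K]
    (hodd : Odd (Module.finrank k K)) (d₁ d₂ : k) (h₁ : d₁ ≠ 0) (h₂ : d₂ ≠ 0) (c : K)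
    (h : algebraMap k K d₁ = c * c * algebraMap k K d₂) :
    ∃ c : k, c ≠ 0 ∧ d₁ = c * c * d₂ := by
  obtain ⟨m, hm⟩ := hodd
  have hN := congrArg (Algebra.norm k) h
  simp only [map_mul, Algebra.norm_algebraMap, hm] at hN
  have key : d₁ = (Algebra.norm k c * (d₂ / d₁) ^ m) * (Algebra.norm k c * (d₂ / d₁) ^ m) * d₂ := by
    have hp : d₁ ^ (2 * m) ≠ 0 := pow_ne_zero _ h₁
    apply mul_left_cancel₀ hp
    have : d₁ ^ m * (d₂ / d₁) ^ m = d₂ ^ m := by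
      rw [← mul_pow, mul_div_cancel₀ _ h₁]
    calc d₁ ^ (2 * m) * d₁ = d₁ ^ (2 * m + 1) := by ring
      _ = _ := hN
      _ = Algebra.norm k c * Algebra.norm k c * (d₂ ^ m * d₂ ^ m) * d₂ := by ring
      _ = _ := by rw [← this]; ring
  refine ⟨_, ?_, key⟩
  intro h0
  rw [h0] at key
  simp at key
  exact h₁ key

/-- Every nondegenerate form is diagonalised with nonzero entries. -/
theorem aux_diag {k V : Type*} {n : ℕ} [Field k] [Invertible (2 : k)]
    [AddCommGroup V] [Module k V] [FiniteDimensional k V] (hn : Module.finrank k V = n)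
    (Q : QuadraticForm k V) (h : Q.polarBilin.SeparatingLeft) :
    ∃ w : Fin n → k, (∀ i, w i ≠ 0) ∧ Q.Equivalent (QuadraticMap.weightedSumSquares k w) := by
  subst hn
  have h' : (QuadraticMap.associated (R := k) Q).SeparatingLeft := by
    intro x hx
    apply h x
    intro y
    rw [← QuadraticMap.two_nsmul_associated k]
    have := hx y
    simp only [LinearMap.smul_apply]
    rw [show (QuadraticMap.associatedHom k Q) x y = 0 from this, smul_zero]
  obtain ⟨w, hw⟩ := QuadraticForm.equivalent_weightedSumSquares_units_of_nondegenerate' Q h'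
  refine ⟨fun i => w i, fun i => (w i).ne_zero, ?_⟩
  convert hw using 1
  ext v
  simp [Units.smul_def]

/-- Let `k ⊆ K` be finite fields of odd characteristic with `[K : k]` odd. Two
nondegenerate quadratic forms over `k` are equivalent if and only if their base
changes to `K` are equivalent. -/
theorem quadraticForm_equivalent_iff_baseChange_equivalent
    {k K : Type*} [Field k] [Field K] [Algebra k K] [Fintype k] [Fintype K]
    [Invertible (2 : k)] (hodd : Odd (Module.finrank k K))
    {V₁ V₂ : Type*} [AddCommGroup V₁] [Module k V₁] [FiniteDimensional k V₁]
    [AddCommGroup V₂] [Module k V₂] [FiniteDimensional k V₂]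
    (Q₁ : QuadraticForm k V₁) (Q₂ : QuadraticForm k V₂)
    (h₁ : Q₁.polarBilin.SeparatingLeft) (h₂ : Q₂.polarBilin.SeparatingLeft) :
    Q₁.Equivalent Q₂ ↔ (Q₁.baseChange K).Equivalent (Q₂.baseChange K) := by
  constructor
  · rintro ⟨e⟩
    let E := LinearEquiv.baseChange k K V₁ V₂ e.toLinearEquiv
    have hE : (Q₂.baseChange K).comp (E : _ →ₗ[K] _) = Q₁.baseChange K := by
      refine baseChange_ext fun m => ?_
      have := e.map_app m
      rw [QuadraticMap.comp_apply]
      change Q₂.baseChange K (1 ⊗ₜ[k] e m) = _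
      rw [QuadraticForm.baseChange_tmul, QuadraticForm.baseChange_tmul, this]
    refine ⟨{ E with map_app' := fun v => ?_ }⟩
    rw [← hE]
    rfl
  · intro h
    letI : Invertible (2 : K) :=
      (Invertible.map (algebraMap k K) 2).copy 2 (map_ofNat _ _).symm
    have hdim : Module.finrank k V₁ = Module.finrank k V₂ := by
      obtain ⟨e⟩ := h
      have := e.toLinearEquiv.finrank_eq
      rwa [Module.finrank_baseChange, Module.finrank_baseChange] at this
    obtain ⟨w₁, hw₁, e₁⟩ := aux_diag rfl Q₁ h₁
    obtain ⟨w₂, hw₂, e₂⟩ := aux_diag hdim.symm Q₂ h₂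
    let b₁ := Module.finBasis k V₁
    let b₂ := Module.finBasisOfFinrankEq k V₂ hdim.symm
    obtain ⟨c₁, hc₁, hd₁⟩ := aux_discr (Pi.basisFun k _) b₁ _ _ e₁.symm
    obtain ⟨c₂, hc₂, hd₂⟩ := aux_discr b₂ (Pi.basisFun k _) _ _ e₂
    rw [aux_discr_wss] at hd₁ hd₂
    obtain ⟨c, hc, hd⟩ := aux_discr (b₁.baseChange K) (b₂.baseChange K) _ _ h
    rw [aux_discr_baseChange, aux_discr_baseChange] at hd
    have hp₁ : ∏ i, w₁ i ≠ 0 := Finset.prod_ne_zero_iff.mpr fun i _ => hw₁ i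
    have hp₂ : ∏ i, w₂ i ≠ 0 := Finset.prod_ne_zero_iff.mpr fun i _ => hw₂ i
    have hD₁ : Q₁.discr b₁ ≠ 0 := by
      intro h0; rw [h0, mul_zero] at hd₁; exact hp₁ hd₁
    have hD₂ : Q₂.discr b₂ ≠ 0 := by
      rw [hd₂]; exact mul_ne_zero (mul_ne_zero hc₂ hc₂) hp₂
    obtain ⟨c', hc', hd'⟩ := aux_square hodd _ _ hD₁ hD₂ c hd
    refine e₁.trans (QuadraticMap.Equivalent.trans ?_ e₂.symm)
    refine aux_classify w₁ w₂ hw₁ hw₂ (c₁ * c' * c₂) (mul_ne_zero (mul_ne_zero hc₁ hc') hc₂) ?_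
    rw [hd₁, hd', hd₂]
    ring
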